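/- arXiv:1904.02229 — 2 statements merged into one kernel-verified Lean document; each statement's English description precedes it below -/
import Mathlib

section
/- Let G be a finite simple graph, let e = uw be an edge of G, and let G' be the graph obtained from G by a 4-fold subdivision of e, i.e. by deleting e and adding four new vertices s_1, s_2, s_3, s_4 together with the path u s_1 s_2 s_3 s_4 w. Then G is a core graph if and only if G' is a core graph, and G is a nut graph if and only if G' is a nut graph. -/
open Matrix

/-- Adjacency matrix of a finite simple graph over `ℚ`. -/
noncomputable def adjMat {V : Type*} [Fintype V] [DecidableEq V] (G : SimpleGraph V) :
    Matrix V V ℚ :=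
  letI := Classical.decRel G.Adj
  G.adjMatrix ℚ

/-- A core graph: some kernel eigenvector of the adjacency matrix has all entries nonzero. -/
def IsCoreGraph {V : Type*} [Fintype V] [DecidableEq V] (G : SimpleGraph V) : Prop :=
  ∃ x : V → ℚ, (adjMat G).mulVec x = 0 ∧ ∀ w, x w ≠ 0

/-- The nullity of a graph: dimension of the kernel of its adjacency matrix. -/
noncomputable def nullity {V : Type*} [Fintype V] [DecidableEq V] (G : SimpleGraph V) : ℕ :=
  Module.finrank ℚ (LinearMap.ker (adjMat G).mulVecLin)

/-- A nut graph: a core graph of nullity one. -/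
def IsNutGraph {V : Type*} [Fintype V] [DecidableEq V] (G : SimpleGraph V) : Prop :=
  IsCoreGraph G ∧ nullity G = 1

/-- A graph is `ρ`-regular if every vertex has degree `ρ`. -/
def IsRegularGraph {V : Type*} (G : SimpleGraph V) (ρ : ℕ) : Prop :=
  ∀ w, Nat.card (G.neighborSet w) = ρ

/-- The Fowler construction `F(G,v)`. -/
def Fowler {V : Type*} (G : SimpleGraph V) (v : V) :
    SimpleGraph (V ⊕ (↥(G.neighborSet v) ⊕ ↥(G.neighborSet v))) :=
  SimpleGraph.fromRel (fun a b =>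
    match a, b with
    | Sum.inl w₁, Sum.inl w₂ => G.Adj w₁ w₂ ∧ w₁ ≠ v ∧ w₂ ≠ v
    | Sum.inl w, Sum.inr (Sum.inl u) => w = (u : V)
    | Sum.inl w, Sum.inr (Sum.inr _) => w = v
    | Sum.inr (Sum.inl u), Sum.inr (Sum.inr u') => (u : V) ≠ (u' : V)
    | _, _ => False)


/-- The graph `G'` obtained from `G` by a 4-fold subdivision of the edge `u w`:
delete the edge `u w` and add a path `u s₁ s₂ s₃ s₄ w` through four new vertices. -/
def Subdiv4 {V : Type*} (G : SimpleGraph V) (u w : V) : SimpleGraph (V ⊕ Fin 4) :=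
  SimpleGraph.fromRel (fun a b =>
    match a, b with
    | Sum.inl x, Sum.inl y => G.Adj x y ∧ ¬(x = u ∧ y = w) ∧ ¬(x = w ∧ y = u)
    | Sum.inl x, Sum.inr i => (x = u ∧ i = 0) ∨ (x = w ∧ i = 3)
    | Sum.inr i, Sum.inr j => (i : ℕ) + 1 = (j : ℕ) ∨ (j : ℕ) + 1 = (i : ℕ)
    | _, _ => False)

open scoped Classical in
lemma adjMat_mulVec_apply {V : Type*} [Fintype V] [DecidableEq V] (G : SimpleGraph V)
    (x : V → ℚ) (v : V) :
    (adjMat G).mulVec x v = ∑ z, if G.Adj v z then x z else 0 := by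
  simp [adjMat, Matrix.mulVec, dotProduct, SimpleGraph.adjMatrix_apply]

section Adjacency

variable {V : Type*} {G : SimpleGraph V} {u w : V}

lemma subdiv4_adj_inl_inl {v z : V} : (Subdiv4 G u w).Adj (Sum.inl v) (Sum.inl z) ↔
    G.Adj v z ∧ ¬(v = u ∧ z = w) ∧ ¬(v = w ∧ z = u) := by
  have := G.adj_comm v z
  have : G.Adj v z → v ≠ z := G.ne_of_adj
  simp only [Subdiv4, SimpleGraph.fromRel_adj, ne_eq, Sum.inl.injEq]
  tauto

lemma subdiv4_adj_inl_inr {v : V} {i : Fin 4} : (Subdiv4 G u w).Adj (Sum.inl v) (Sum.inr i) ↔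
    (v = u ∧ i = 0) ∨ (v = w ∧ i = 3) := by
  simp [Subdiv4, SimpleGraph.fromRel_adj]

lemma subdiv4_adj_inr_inr {i j : Fin 4} : (Subdiv4 G u w).Adj (Sum.inr i) (Sum.inr j) ↔
    (i : ℕ) + 1 = j ∨ (j : ℕ) + 1 = i := by
  simp only [Subdiv4, SimpleGraph.fromRel_adj, ne_eq, Sum.inr.injEq, Fin.ext_iff]
  omega

end Adjacency

section Kernel

variable {V : Type*} [Fintype V] [DecidableEq V] {G : SimpleGraph V} {u w : V}

lemma subdiv4_mulVec_inl (huw : G.Adj u w) (y : V ⊕ Fin 4 → ℚ) (v : V) :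
    (adjMat (Subdiv4 G u w)).mulVec y (Sum.inl v) =
      (adjMat G).mulVec (fun z => y (Sum.inl z)) v +
        (if v = u then y (Sum.inr 0) - y (Sum.inl w) else 0) +
        (if v = w then y (Sum.inr 3) - y (Sum.inl u) else 0) := by
  classical
  have hne : u ≠ w := huw.ne
  have key : ∀ z, (if (Subdiv4 G u w).Adj (Sum.inl v) (Sum.inl z) then y (Sum.inl z) else 0) =
      (if G.Adj v z then y (Sum.inl z) else 0) -
        (if z = w then if v = u then y (Sum.inl z) else 0 else 0) -
        (if z = u then if v = w then y (Sum.inl z) else 0 else 0) := by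
    intro z
    have := huw.symm
    rw [subdiv4_adj_inl_inl]
    grind
  rw [adjMat_mulVec_apply, adjMat_mulVec_apply, Fintype.sum_sum_type, Finset.sum_congr rfl
    fun z _ => key z]
  simp only [Finset.sum_sub_distrib, Finset.sum_ite_eq', Finset.mem_univ, if_true,
    Fin.sum_univ_four, subdiv4_adj_inl_inr]
  by_cases h1 : v = u <;> by_cases h2 : v = w <;> simp_all <;> ring

lemma subdiv4_mulVec_inr (y : V ⊕ Fin 4 → ℚ) (i : Fin 4) :
    (adjMat (Subdiv4 G u w)).mulVec y (Sum.inr i) =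
      ![y (Sum.inl u) + y (Sum.inr 1), y (Sum.inr 0) + y (Sum.inr 2),
        y (Sum.inr 1) + y (Sum.inr 3), y (Sum.inl w) + y (Sum.inr 2)] i := by
  classical
  rw [adjMat_mulVec_apply, Fintype.sum_sum_type]
  simp only [Fin.sum_univ_four, subdiv4_adj_inr_inr,
    (Subdiv4 G u w).adj_comm (Sum.inr i) (Sum.inl _), subdiv4_adj_inl_inr]
  fin_cases i <;> simp

/-- The extension of a vector on `G` to the 4-fold subdivision of the edge `u w`. -/
def subdiv4Extend (u w : V) (x : V → ℚ) : V ⊕ Fin 4 → ℚ :=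
  Sum.elim x ![x w, -x u, -x w, x u]

lemma subdiv4Extend_mulVec_eq_zero (huw : G.Adj u w) {x : V → ℚ}
    (hx : (adjMat G).mulVec x = 0) :
    (adjMat (Subdiv4 G u w)).mulVec (subdiv4Extend u w x) = 0 := by
  ext (v | i)
  · rw [subdiv4_mulVec_inl huw]
    simp [subdiv4Extend, hx]
  · rw [subdiv4_mulVec_inr]
    fin_cases i <;> simp [subdiv4Extend]

lemma eq_subdiv4Extend {y : V ⊕ Fin 4 → ℚ}
    (hy : (adjMat (Subdiv4 G u w)).mulVec y = 0) :
    y = subdiv4Extend u w (fun z => y (Sum.inl z)) := by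
  have h i := (subdiv4_mulVec_inr y i).symm.trans (congrFun hy (Sum.inr i))
  have h0 := h 0
  have h1 := h 1
  have h2 := h 2
  have h3 := h 3
  simp at h0 h1 h2 h3
  ext (v | i)
  · rfl
  · fin_cases i <;> simp [subdiv4Extend] <;> linarith

lemma mulVec_restrict_eq_zero (huw : G.Adj u w) {y : V ⊕ Fin 4 → ℚ}
    (hy : (adjMat (Subdiv4 G u w)).mulVec y = 0) :
    (adjMat G).mulVec (fun z => y (Sum.inl z)) = 0 := by
  ext v
  have h := subdiv4_mulVec_inl huw y v
  have h0 := congrFun (eq_subdiv4Extend hy) (Sum.inr 0)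
  have h3 := congrFun (eq_subdiv4Extend hy) (Sum.inr 3)
  simp [subdiv4Extend] at h0 h3
  simpa [hy, h0, h3] using h.symm

/-- Restriction to the original vertices identifies the kernel of the 4-fold subdivision
with the kernel of the graph. -/
def subdiv4KerEquiv (huw : G.Adj u w) :
    LinearMap.ker (adjMat (Subdiv4 G u w)).mulVecLin ≃ₗ[ℚ] LinearMap.ker (adjMat G).mulVecLin where
  toFun y := ⟨fun z => y.1 (Sum.inl z), mulVec_restrict_eq_zero huw y.2⟩
  map_add' _ _ := rfl
  map_smul' _ _ := rfl
  invFun x := ⟨subdiv4Extend u w x.1, subdiv4Extend_mulVec_eq_zero huw x.2⟩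
  left_inv y := Subtype.ext (eq_subdiv4Extend y.2).symm
  right_inv _ := rfl

lemma nullity_subdiv4 (huw : G.Adj u w) : nullity (Subdiv4 G u w) = nullity G :=
  (subdiv4KerEquiv huw).finrank_eq

lemma isCoreGraph_subdiv4_iff (huw : G.Adj u w) :
    IsCoreGraph G ↔ IsCoreGraph (Subdiv4 G u w) := by
  constructor
  · rintro ⟨x, hx, hne⟩
    refine ⟨_, subdiv4Extend_mulVec_eq_zero huw hx, ?_⟩
    rintro (v | i)
    · exact hne v
    · fin_cases i <;> simp [subdiv4Extend, hne]
  · rintro ⟨y, hy, hne⟩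
    exact ⟨_, mulVec_restrict_eq_zero huw hy, fun z => hne (Sum.inl z)⟩

end Kernel

/-- A 4-fold subdivision of an edge preserves both the core-graph property and the
nut-graph property. -/
theorem subdiv4_core_and_nut {V : Type*} [Fintype V] [DecidableEq V]
    (G : SimpleGraph V) (u w : V) (huw : G.Adj u w) :
    (IsCoreGraph G ↔ IsCoreGraph (Subdiv4 G u w)) ∧
      (IsNutGraph G ↔ IsNutGraph (Subdiv4 G u w)) := by
  refine ⟨isCoreGraph_subdiv4_iff huw, ?_⟩
  rw [IsNutGraph, IsNutGraph, nullity_subdiv4 huw, isCoreGraph_subdiv4_iff huw]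
end

section
/- Fix ρ ≥ 1. If there exists a ρ-regular nut graph, then there exist infinitely many ρ-regular nut graphs: for every natural number N there exists a ρ-regular nut graph on more than N vertices. -/
open Matrix

section Adjacency

variable {V : Type*} [Fintype V] [DecidableEq V] (G : SimpleGraph V)

open Classical in
lemma adjMat_mulVec_apply_s13 (x : V → ℚ) (w : V) :
    (adjMat G *ᵥ x) w = ∑ u, if G.Adj w u then x u else 0 := by
  simp [adjMat, Matrix.mulVec, dotProduct, SimpleGraph.adjMatrix_apply]

lemma adjMat_mulVec_apply_eq_sum_neighborSet (v : V) [Fintype (G.neighborSet v)] (x : V → ℚ) :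
    (adjMat G *ᵥ x) v = ∑ u : G.neighborSet v, x u := by
  classical
  rw [adjMat_mulVec_apply_s13, ← Finset.sum_filter]
  exact Finset.sum_subtype _ (by simp) x

lemma isRegularGraph_iff_mulVec_one (ρ : ℕ) :
    IsRegularGraph G ρ ↔ ∀ w, (adjMat G *ᵥ 1) w = ρ := by
  classical
  refine forall_congr' fun w => ?_
  rw [adjMat_mulVec_apply_eq_sum_neighborSet]
  simp [Nat.card_eq_fintype_card]

lemma isNutGraph_iff : IsNutGraph G ↔ ∃ x : V → ℚ, adjMat G *ᵥ x = 0 ∧ (∀ w, x w ≠ 0) ∧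
    Nonempty V ∧ ∀ y, adjMat G *ᵥ y = 0 → ∃ c : ℚ, c • x = y := by
  constructor
  · rintro ⟨⟨x, hx, hx0⟩, h⟩
    have hne : Nonempty V := by
      by_contra hV
      rw [not_nonempty_iff] at hV
      rw [nullity, Module.finrank_zero_of_subsingleton] at h
      exact zero_ne_one h
    refine ⟨x, hx, hx0, hne, fun y hy => ?_⟩
    obtain ⟨w⟩ := hne
    let x' : LinearMap.ker (adjMat G).mulVecLin := ⟨x, hx⟩
    have hx' : x' ≠ 0 := fun h0 => hx0 w (congrFun (congrArg Subtype.val h0) w)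
    obtain ⟨c, hc⟩ := (finrank_eq_one_iff_of_nonzero' x' hx').mp h ⟨y, hy⟩
    exact ⟨c, congrArg Subtype.val hc⟩
  · rintro ⟨x, hx, hx0, ⟨w⟩, h⟩
    refine ⟨⟨x, hx, hx0⟩, ?_⟩
    let x' : LinearMap.ker (adjMat G).mulVecLin := ⟨x, hx⟩
    have hx' : x' ≠ 0 := fun h0 => hx0 w (congrFun (congrArg Subtype.val h0) w)
    refine (finrank_eq_one_iff_of_nonzero' x' hx').mpr fun y => ?_
    obtain ⟨c, hc⟩ := h y y.2
    exact ⟨c, Subtype.ext hc⟩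

variable {G}

lemma IsNutGraph.nonempty (h : IsNutGraph G) : Nonempty V := by
  obtain ⟨_, _, _, hV, _⟩ := (isNutGraph_iff G).mp h
  exact hV

/-- A vertex of degree one forces a kernel vector to vanish at its neighbour. -/
lemma IsCoreGraph.card_neighborSet_ne_one (h : IsCoreGraph G) (v : V) :
    Nat.card (G.neighborSet v) ≠ 1 := by
  classical
  obtain ⟨x, hx, hx0⟩ := h
  intro hcard
  rw [Nat.card_eq_fintype_card, Fintype.card_eq_one_iff] at hcard
  obtain ⟨u, hu⟩ := hcard
  have hv := congrFun hx v
  rw [adjMat_mulVec_apply_eq_sum_neighborSet, Fintype.sum_eq_single u fun z hz => (hz (hu z)).elim]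
    at hv
  exact hx0 u hv

variable {W : Type*} [Fintype W] [DecidableEq W] {H : SimpleGraph W}

lemma SimpleGraph.Iso.adjMat_mulVec_comp (e : G ≃g H) (x : W → ℚ) :
    adjMat G *ᵥ (x ∘ e) = (adjMat H *ᵥ x) ∘ e := by
  classical
  funext w
  simp only [adjMat_mulVec_apply_s13, Function.comp_apply]
  exact Fintype.sum_equiv e.toEquiv _ _ fun u => if_congr e.map_adj_iff.symm rfl rfl

lemma IsNutGraph.of_iso (h : IsNutGraph G) (e : G ≃g H) : IsNutGraph H := by
  rw [isNutGraph_iff] at h ⊢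
  obtain ⟨x, hx, hx0, hne, huniq⟩ := h
  refine ⟨x ∘ e.symm, by rw [e.symm.adjMat_mulVec_comp, hx]; rfl, fun w => hx0 _,
    hne.map e, fun y hy => ?_⟩
  obtain ⟨c, hc⟩ := huniq (y ∘ e) (by rw [e.adjMat_mulVec_comp, hy]; rfl)
  refine ⟨c, funext fun w => ?_⟩
  simpa using congrFun hc (e.symm w)

end Adjacency

lemma IsRegularGraph.of_iso {V W : Type*} {G : SimpleGraph V} {H : SimpleGraph W} {ρ : ℕ}
    (h : IsRegularGraph G ρ) (e : G ≃g H) : IsRegularGraph H ρ := by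
  intro w
  rw [← h (e.symm w)]
  exact Nat.card_congr (e.symm.mapNeighborSet w)

namespace Fowler

section Adj

variable {V : Type*} {G : SimpleGraph V} {v : V}

@[simp] lemma adj_inl_inl (w₁ w₂ : V) :
    (Fowler G v).Adj (.inl w₁) (.inl w₂) ↔ G.Adj w₁ w₂ ∧ w₁ ≠ v ∧ w₂ ≠ v := by
  have := @SimpleGraph.Adj.ne V G w₁ w₂
  simp only [Fowler, SimpleGraph.fromRel_adj, G.adj_comm w₂ w₁, ne_eq, Sum.inl.injEq]
  tauto

@[simp] lemma adj_inl_inner (w : V) (u : G.neighborSet v) :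
    (Fowler G v).Adj (.inl w) (.inr (.inl u)) ↔ w = u := by
  simp [Fowler]

@[simp] lemma adj_inl_outer (w : V) (u : G.neighborSet v) :
    (Fowler G v).Adj (.inl w) (.inr (.inr u)) ↔ w = v := by
  simp [Fowler]

@[simp] lemma adj_inner_inl (w : V) (u : G.neighborSet v) :
    (Fowler G v).Adj (.inr (.inl u)) (.inl w) ↔ w = u := by
  simp [Fowler]

@[simp] lemma adj_outer_inl (w : V) (u : G.neighborSet v) :
    (Fowler G v).Adj (.inr (.inr u)) (.inl w) ↔ w = v := by
  simp [Fowler]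

@[simp] lemma adj_inner_inner (u u' : G.neighborSet v) :
    ¬ (Fowler G v).Adj (.inr (.inl u)) (.inr (.inl u')) := by
  simp [Fowler]

@[simp] lemma adj_outer_outer (u u' : G.neighborSet v) :
    ¬ (Fowler G v).Adj (.inr (.inr u)) (.inr (.inr u')) := by
  simp [Fowler]

@[simp] lemma adj_inner_outer (u u' : G.neighborSet v) :
    (Fowler G v).Adj (.inr (.inl u)) (.inr (.inr u')) ↔ u ≠ u' := by
  simp [Fowler, Subtype.ext_iff]

@[simp] lemma adj_outer_inner (u u' : G.neighborSet v) :
    (Fowler G v).Adj (.inr (.inr u)) (.inr (.inl u')) ↔ u ≠ u' := by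
  simp [Fowler, Subtype.ext_iff, eq_comm]

end Adj

section Extend

variable {V : Type*} [DecidableEq V] {G : SimpleGraph V} {v : V} [Fintype (G.neighborSet v)]

variable (G v) in
/-- The kernel vector of `Fowler G v` induced by a kernel vector `x` of `G`. -/
def extend (x : V → ℚ) : V ⊕ (G.neighborSet v ⊕ G.neighborSet v) → ℚ
  | .inl w => if w = v then (1 - Fintype.card (G.neighborSet v)) * x v else x w
  | .inr (.inl _) => x v
  | .inr (.inr u) => x u

lemma extend_smul (c : ℚ) (x : V → ℚ) : extend G v (c • x) = c • extend G v x := by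
  funext a
  rcases a with w | u | u <;> simp [extend, mul_left_comm]

end Extend

section Kernel

variable {V : Type*} [Fintype V] [DecidableEq V] {G : SimpleGraph V} {v : V}
  [Fintype (G.neighborSet v)] (y : V ⊕ (G.neighborSet v ⊕ G.neighborSet v) → ℚ)

lemma mulVec_center : (adjMat (Fowler G v) *ᵥ y) (.inl v) = ∑ u, y (.inr (.inr u)) := by
  have h (u : G.neighborSet v) : v ≠ u := G.ne_of_adj u.2
  simp [adjMat_mulVec_apply_s13, h]

lemma mulVec_inl_neighbor (u : G.neighborSet v) :
    (adjMat (Fowler G v) *ᵥ y) (.inl u) =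
      (adjMat G *ᵥ fun w => y (.inl w)) u - y (.inl v) + y (.inr (.inl u)) := by
  classical
  have hu : (u : V) ≠ v := (G.ne_of_adj u.2).symm
  have hadj : G.Adj u v := G.adj_symm u.2
  have h : (∑ w, if G.Adj u w ∧ w ≠ v then y (.inl w) else 0) =
      (∑ w, if G.Adj u w then y (.inl w) else 0) - y (.inl v) := by
    rw [eq_sub_iff_add_eq, ← Fintype.sum_ite_eq' v fun w => y (.inl w), ← Finset.sum_add_distrib]
    refine Finset.sum_congr rfl fun w _ => ?_
    by_cases hw : w = v <;> simp [hw, hadj]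
  simp [adjMat_mulVec_apply_s13, hu, ← h, ← Subtype.ext_iff]

lemma mulVec_inl_of_not_adj {w : V} (hw : w ≠ v) (hadj : ¬ G.Adj v w) :
    (adjMat (Fowler G v) *ᵥ y) (.inl w) = (adjMat G *ᵥ fun w => y (.inl w)) w := by
  classical
  have h (u : G.neighborSet v) : w ≠ u := fun h => hadj (h ▸ u.2)
  have h' (z : V) : (G.Adj w z ∧ ¬ z = v) ↔ G.Adj w z :=
    ⟨And.left, fun hz => ⟨hz, fun hzv => hadj (hzv ▸ G.adj_symm hz)⟩⟩
  simp [adjMat_mulVec_apply_s13, hw, h, h']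

lemma sum_ite_eq_zero_else {ι : Type*} [Fintype ι] [DecidableEq ι] (f : ι → ℚ) (i : ι) :
    (∑ j, if i = j then 0 else f j) = ∑ j, f j - f i := by
  rw [eq_sub_iff_add_eq, ← Fintype.sum_ite_eq i f, ← Finset.sum_add_distrib]
  exact Finset.sum_congr rfl fun j _ => by split_ifs <;> simp

lemma mulVec_inner (u : G.neighborSet v) :
    (adjMat (Fowler G v) *ᵥ y) (.inr (.inl u)) =
      y (.inl u) + (∑ u', y (.inr (.inr u')) - y (.inr (.inr u))) := by
  classical
  simp [adjMat_mulVec_apply_s13, sum_ite_eq_zero_else]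

lemma mulVec_outer (u : G.neighborSet v) :
    (adjMat (Fowler G v) *ᵥ y) (.inr (.inr u)) =
      y (.inl v) + (∑ u', y (.inr (.inl u')) - y (.inr (.inl u))) := by
  classical
  simp [adjMat_mulVec_apply_s13, sum_ite_eq_zero_else]

lemma isRegularGraph {ρ : ℕ} (h : IsRegularGraph G ρ) : IsRegularGraph (Fowler G v) ρ := by
  have hcard : (G.neighborSet v).ncard = ρ := h v
  rw [isRegularGraph_iff_mulVec_one] at h ⊢
  rintro (w | u | u)
  · by_cases hw : w = v
    · subst hw
      simp [mulVec_center, hcard]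
    by_cases hadj : G.Adj v w
    · have := mulVec_inl_neighbor (1 : V ⊕ (G.neighborSet v ⊕ G.neighborSet v) → ℚ) ⟨w, hadj⟩
      simpa [← Pi.one_def, h] using this
    · simpa [← Pi.one_def, h] using mulVec_inl_of_not_adj 1 hw hadj
  · simp [mulVec_inner, hcard]
  · simp [mulVec_outer, hcard]

lemma mulVec_update (x : V → ℚ) (w : V) (a : ℚ) :
    (adjMat G *ᵥ fun z => if z = v then a else x z) w =
      (adjMat G *ᵥ x) w + adjMat G w v * (a - x v) := by
  have h : (fun z => if z = v then a else x z) = x + Pi.single v (a - x v) := by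
    funext z
    by_cases hz : z = v
    · subst hz; simp
    · simp [hz]
  rw [h, Matrix.mulVec_add, Pi.add_apply, Matrix.mulVec_single]
  simp

lemma adjMat_apply_of_adj {w z : V} (h : G.Adj w z) : adjMat G w z = 1 := by
  simp [adjMat, h]

lemma adjMat_apply_of_not_adj {w z : V} (h : ¬ G.Adj w z) : adjMat G w z = 0 := by
  simp [adjMat, h]

lemma mulVec_extend {x : V → ℚ} (hx : adjMat G *ᵥ x = 0) :
    adjMat (Fowler G v) *ᵥ extend G v x = 0 := by
  have hsum : ∑ u : G.neighborSet v, x u = 0 := by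
    rw [← adjMat_mulVec_apply_eq_sum_neighborSet, hx, Pi.zero_apply]
  funext a
  rcases a with w | u | u
  · by_cases hw : w = v
    · subst hw
      simpa [mulVec_center, extend] using hsum
    by_cases hadj : G.Adj v w
    · have := mulVec_inl_neighbor (extend G v x) ⟨w, hadj⟩
      simp only [extend, mulVec_update, adjMat_apply_of_adj (G.adj_symm hadj), hx, if_true] at this
      rw [this]
      simp
    · rw [mulVec_inl_of_not_adj _ hw hadj]
      simp [extend, mulVec_update, hx, adjMat_apply_of_not_adj fun h => hadj (G.adj_symm h)]
  · have hu : (u : V) ≠ v := (G.ne_of_adj u.2).symm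
    simp [mulVec_inner, extend, hu, hsum]
  · simp [mulVec_outer, extend]
    ring

lemma exists_eq_extend (hdeg : Nonempty (G.neighborSet v))
    (hy : adjMat (Fowler G v) *ᵥ y = 0) :
    ∃ x, adjMat G *ᵥ x = 0 ∧ extend G v x = y := by
  obtain ⟨u₀⟩ := hdeg
  have hsum : ∑ u, y (.inr (.inr u)) = 0 := by rw [← mulVec_center, hy, Pi.zero_apply]
  have houter (u : G.neighborSet v) : y (.inr (.inr u)) = y (.inl u) := by
    have := congrFun hy (.inr (.inl u))
    rw [mulVec_inner, hsum, Pi.zero_apply] at this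
    linarith
  have hrow (u : G.neighborSet v) := (mulVec_outer y u).symm.trans (congrFun hy (.inr (.inr u)))
  have hconst (u : G.neighborSet v) : y (.inr (.inl u)) = y (.inr (.inl u₀)) := by
    have h₁ := hrow u
    have h₂ := hrow u₀
    simp only [Pi.zero_apply] at h₁ h₂
    linarith
  have hcenter : y (.inl v) =
      (1 - Fintype.card (G.neighborSet v)) * y (.inr (.inl u₀)) := by
    have h := hrow u₀
    simp only [hconst, Finset.sum_const, Finset.card_univ, nsmul_eq_mul, Pi.zero_apply] at h
    linarith
  have hne (u : G.neighborSet v) : (u : V) ≠ v := (G.ne_of_adj u.2).symm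
  refine ⟨fun w => if w = v then y (.inr (.inl u₀)) else y (.inl w), ?_, ?_⟩
  · funext w
    by_cases hw : w = v
    · subst hw
      rw [adjMat_mulVec_apply_eq_sum_neighborSet]
      simpa [hne, houter] using hsum
    rw [mulVec_update (v := v) (fun w => y (.inl w))]
    have hw0 := congrFun hy (.inl w)
    by_cases hadj : G.Adj v w
    · have h := mulVec_inl_neighbor y ⟨w, hadj⟩
      rw [hw0, hconst] at h
      rw [adjMat_apply_of_adj (G.adj_symm hadj)]
      simp only [Pi.zero_apply] at h ⊢
      linarith
    · rw [mulVec_inl_of_not_adj y hw hadj] at hw0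
      simp [hw0, adjMat_apply_of_not_adj fun h => hadj (G.adj_symm h)]
  · funext a
    rcases a with w | u | u
    · by_cases hw : w = v
      · subst hw; simp [extend, hcenter]
      · simp [extend, hw]
    · simp [extend, hconst u]
    · simp [extend, hne, houter]

lemma isNutGraph (hdeg : Nonempty (G.neighborSet v)) (h : IsNutGraph G) :
    IsNutGraph (Fowler G v) := by
  have hcard : Fintype.card (G.neighborSet v) ≠ 1 := by
    rw [← Nat.card_eq_fintype_card]
    exact h.1.card_neighborSet_ne_one v
  have hcard' : (1 : ℚ) - Fintype.card (G.neighborSet v) ≠ 0 :=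
    sub_ne_zero.mpr (by exact_mod_cast hcard.symm)
  rw [isNutGraph_iff] at h ⊢
  obtain ⟨x, hx, hx0, hne, huniq⟩ := h
  refine ⟨extend G v x, mulVec_extend hx, ?_, inferInstance, fun y hy => ?_⟩
  · rintro (w | u | u)
    · by_cases hw : w = v
      · simpa [extend, hw, hx0] using hcard'
      · simpa [extend, hw] using hx0 w
    · exact hx0 v
    · exact hx0 u
  · obtain ⟨x', hx', rfl⟩ := exists_eq_extend y hdeg hy
    obtain ⟨c, rfl⟩ := huniq x' hx'
    exact ⟨c, (extend_smul c x).symm⟩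

end Kernel

end Fowler

/-- From a `ρ`-regular nut graph with `ρ ≥ 1` one obtains a strictly larger one. -/
lemma exists_larger_regular_nut_graph {n ρ : ℕ} (hρ : 1 ≤ ρ) {G : SimpleGraph (Fin n)}
    (hreg : IsRegularGraph G ρ) (hnut : IsNutGraph G) :
    ∃ (m : ℕ) (H : SimpleGraph (Fin m)), n < m ∧ IsRegularGraph H ρ ∧ IsNutGraph H := by
  classical
  obtain ⟨v⟩ := hnut.nonempty
  have hcard : 0 < Fintype.card (G.neighborSet v) := by
    rw [← Nat.card_eq_fintype_card, hreg v]
    exact hρ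
  let e := SimpleGraph.overFinIso (Fowler G v) rfl
  refine ⟨_, _, ?_, (Fowler.isRegularGraph hreg).of_iso e,
    (Fowler.isNutGraph (Fintype.card_pos_iff.mp hcard) hnut).of_iso e⟩
  simp only [Fintype.card_sum, Fintype.card_fin]
  omega

/-- If there is a `ρ`-regular nut graph, then there are `ρ`-regular nut graphs of
arbitrarily large order. -/
theorem infinitely_many_regular_nut_graphs (rho : ℕ) (hrho : 1 ≤ rho)
    (h : ∃ (n : ℕ) (G : SimpleGraph (Fin n)), IsRegularGraph G rho ∧ IsNutGraph G) :
    ∀ N : ℕ, ∃ (n : ℕ) (G : SimpleGraph (Fin n)),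
      N < n ∧ IsRegularGraph G rho ∧ IsNutGraph G := by
  intro N
  induction N with
  | zero =>
    obtain ⟨n, G, hreg, hnut⟩ := h
    obtain ⟨m, H, hlt, hH⟩ := exists_larger_regular_nut_graph hrho hreg hnut
    exact ⟨m, H, by omega, hH⟩
  | succ N ih =>
    obtain ⟨n, G, hN, hreg, hnut⟩ := ih
    obtain ⟨m, H, hlt, hH⟩ := exists_larger_regular_nut_graph hrho hreg hnut
    exact ⟨m, H, by omega, hH⟩
end
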